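/- Consider the nonsymmetric Arrow-Debreu Nash bargaining program, and let x be an allocation with Σ_{j} U_{ij}x_{ij} − c_i > 0 for all i∈B. Then x is an optimal solution of the program if and only if there exist prices p_j > 0 for the goods such that (i) Σ_{i∈B} x_{ij} = 1 for every good j (every good is fully sold), and (ii) for every buyer i and good j, U_{ij}/p_j ≤ (Σ_{k∈G} U_{ik}x_{ik} − c_i)/m_i, with equality whenever x_{ij}>0. -/

import Mathlib

open Finset

variable {B G : Type*} [Fintype B] [Fintype G]

/-- An allocation of the goods: `x ≥ 0` and each good is allocated at most once. -/
def IsAllocation (x : B → G → ℝ) : Prop :=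
  (∀ i j, 0 ≤ x i j) ∧ ∀ j, ∑ i, x i j ≤ 1

/-- The surplus utility `Σ_j U_{ij} x_{ij} − c_i` of buyer `i`. -/
noncomputable def surplus (U : B → G → ℝ) (c : B → ℝ) (x : B → G → ℝ) (i : B) : ℝ :=
  ∑ j, U i j * x i j - c i

/-- A feasible point of the nonsymmetric ADNB program. -/
def IsFeasibleADNB (U : B → G → ℝ) (c : B → ℝ) (x : B → G → ℝ) : Prop :=
  IsAllocation x ∧ ∀ i, 0 < surplus U c x i

/-- The objective `Σ_i m_i · log(Σ_j U_{ij} x_{ij} − c_i)`. -/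
noncomputable def objADNB (U : B → G → ℝ) (m : B → ℝ) (c : B → ℝ) (x : B → G → ℝ) : ℝ :=
  ∑ i, m i * Real.log (surplus U c x i)

open Filter Topology

/-- The marginal value `m_i U_{ij} / s_i(x)` of good `j` to buyer `i` at the allocation `x`. -/
noncomputable def marginalValue (U : B → G → ℝ) (m : B → ℝ) (c : B → ℝ) (x : B → G → ℝ)
    (i : B) (j : G) : ℝ :=
  m i * U i j / surplus U c x i

theorem surplus_sub_surplus {B G : Type*} [Fintype G] (U : B → G → ℝ) (c : B → ℝ)
    (x y : B → G → ℝ) (i : B) :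
    surplus U c y i - surplus U c x i = ∑ j, U i j * (y i j - x i j) := by
  simp [surplus, mul_sub]

theorem surplus_segment {B G : Type*} [Fintype G] (U : B → G → ℝ) (c : B → ℝ)
    (x y : B → G → ℝ) (t : ℝ) (i : B) :
    surplus U c (fun i j => x i j + t * (y i j - x i j)) i =
      surplus U c x i + t * (surplus U c y i - surplus U c x i) := by
  simp only [surplus, mul_add, sum_add_distrib, mul_sub, mul_left_comm _ t, sum_sub_distrib,
    ← mul_sum]
  ring

theorem IsAllocation.segment {B G : Type*} [Fintype B] {x y : B → G → ℝ}
    (hx : IsAllocation x) (hy : IsAllocation y) {t : ℝ} (ht0 : 0 ≤ t) (ht1 : t ≤ 1) :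
    IsAllocation fun i j => x i j + t * (y i j - x i j) := by
  refine ⟨fun i j => ?_, fun j => ?_⟩
  · nlinarith [hx.1 i j, hy.1 i j]
  · simp only [sum_add_distrib, ← mul_sum, sum_sub_distrib]
    nlinarith [hx.2 j, hy.2 j]

theorem sum_surplus_diff_div (U : B → G → ℝ) (m : B → ℝ) (c : B → ℝ) (x y : B → G → ℝ) :
    ∑ i, m i * ((surplus U c y i - surplus U c x i) / surplus U c x i) =
      ∑ j, ∑ i, marginalValue U m c x i j * y i j -
        ∑ j, ∑ i, marginalValue U m c x i j * x i j := by
  rw [← sum_sub_distrib, sum_congr rfl fun j _ => (sum_sub_distrib _ _).symm, sum_comm]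
  refine sum_congr rfl fun i _ => ?_
  rw [surplus_sub_surplus, sum_div, mul_sum]
  refine sum_congr rfl fun j _ => ?_
  rw [marginalValue]
  ring

/-- The concave objective lies below its linearization at a feasible point. -/
theorem objADNB_sub_le {U : B → G → ℝ} {m c : B → ℝ} (hm : ∀ i, 0 < m i) {x y : B → G → ℝ}
    (hx : ∀ i, 0 < surplus U c x i) (hy : ∀ i, 0 < surplus U c y i) :
    objADNB U m c y - objADNB U m c x ≤
      ∑ i, m i * ((surplus U c y i - surplus U c x i) / surplus U c x i) := by
  rw [objADNB, objADNB, ← sum_sub_distrib]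
  refine sum_le_sum fun i _ => ?_
  rw [← mul_sub, ← Real.log_div (hy i).ne' (hx i).ne', sub_div, div_self (hx i).ne']
  exact mul_le_mul_of_nonneg_left (Real.log_le_sub_one_of_pos (div_pos (hy i) (hx i))) (hm i).le

/-- First-order optimality: at an optimal point no direction towards an allocation is improving. -/
theorem sum_marginalValue_le_of_optimal {U : B → G → ℝ} {m c : B → ℝ} (hm : ∀ i, 0 < m i)
    {x y : B → G → ℝ} (hx : IsFeasibleADNB U c x)
    (hopt : ∀ y, IsFeasibleADNB U c y → objADNB U m c y ≤ objADNB U m c x)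
    (hy : IsAllocation y) :
    ∑ j, ∑ i, marginalValue U m c x i j * y i j ≤
      ∑ j, ∑ i, marginalValue U m c x i j * x i j := by
  rw [← sub_nonpos, ← sum_surplus_diff_div]
  set d : B → ℝ := fun i => surplus U c y i - surplus U c x i
  have hcont (i : B) : Tendsto (fun t : ℝ => surplus U c x i + t * d i) (𝓝[>] 0)
      (𝓝 (surplus U c x i)) := by
    have h : Continuous fun t : ℝ => surplus U c x i + t * d i := by fun_prop
    simpa using (h.tendsto 0).mono_left nhdsWithin_le_nhds
  have hlim : Tendsto (fun t : ℝ => ∑ i, m i * (d i / (surplus U c x i + t * d i))) (𝓝[>] 0)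
      (𝓝 (∑ i, m i * (d i / surplus U c x i))) :=
    tendsto_finsetSum _ fun i _ =>
      (tendsto_const_nhds.div (hcont i) (hx.2 i).ne').const_mul (m i)
  refine le_of_tendsto hlim ?_
  have hpos : ∀ᶠ t in 𝓝[>] (0 : ℝ), ∀ i, 0 < surplus U c x i + t * d i :=
    eventually_all.2 fun i => (hcont i).eventually (lt_mem_nhds (hx.2 i))
  filter_upwards [hpos, Ioc_mem_nhdsGT (zero_lt_one' ℝ)] with t ht ht01
  set z : B → G → ℝ := fun i j => x i j + t * (y i j - x i j)
  have hz (i : B) : surplus U c z i = surplus U c x i + t * d i := surplus_segment U c x y t i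
  have hzpos (i : B) : 0 < surplus U c z i := hz i ▸ ht i
  have hle := hopt z ⟨hx.1.segment hy ht01.1.le ht01.2, hzpos⟩
  have hlin := objADNB_sub_le hm hzpos hx.2
  have hsum : ∑ i, m i * ((surplus U c x i - surplus U c z i) / surplus U c z i) =
      -(t * ∑ i, m i * (d i / (surplus U c x i + t * d i))) := by
    rw [mul_sum, ← sum_neg_distrib]
    refine sum_congr rfl fun i _ => ?_
    rw [hz]
    ring
  rw [hsum] at hlin
  exact nonpos_of_mul_nonpos_right (by linarith) ht01.1

/-- Let `x` be a feasible point of the nonsymmetric ADNB program. Then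
`x` is optimal if and only if there are prices `p_j > 0` such that (i) every good is fully
sold, `Σ_i x_{ij} = 1`, and (ii) for every buyer `i` and good `j`,
`U_{ij}/p_j ≤ (Σ_k U_{ik} x_{ik} − c_i)/m_i`, with equality whenever `x_{ij} > 0`. -/
theorem adnb_kkt
    (U : B → G → ℝ) (m : B → ℝ) (c : B → ℝ)
    (hU : ∀ i j, 0 ≤ U i j) (hm : ∀ i, 0 < m i) (hc : ∀ i, 0 ≤ c i)
    (hbuyer : ∀ i : B, ∃ j, 0 < U i j) (hgood : ∀ j : G, ∃ i, 0 < U i j)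
    (x : B → G → ℝ) (hfeas : IsFeasibleADNB U c x) :
    (∀ y, IsFeasibleADNB U c y → objADNB U m c y ≤ objADNB U m c x) ↔
    ∃ p : G → ℝ, (∀ j, 0 < p j) ∧ (∀ j, ∑ i, x i j = 1) ∧
      ∀ i j, U i j / p j ≤ surplus U c x i / m i ∧
        (0 < x i j → U i j / p j = surplus U c x i / m i) := by
  classical
  have hle (p : G → ℝ) (hp : ∀ j, 0 < p j) (i : B) (j : G) :
      U i j / p j ≤ surplus U c x i / m i ↔ marginalValue U m c x i j ≤ p j := by
    rw [marginalValue, div_le_div_iff₀ (hp j) (hm i), div_le_iff₀ (hfeas.2 i), mul_comm (m i),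
      mul_comm (p j)]
  have heq (p : G → ℝ) (hp : ∀ j, 0 < p j) (i : B) (j : G) :
      U i j / p j = surplus U c x i / m i ↔ marginalValue U m c x i j = p j := by
    rw [marginalValue, div_eq_div_iff (hp j).ne' (hm i).ne', div_eq_iff (hfeas.2 i).ne',
      mul_comm (m i), mul_comm (p j)]
  constructor
  · intro hopt
    have hmax (j : G) : ∃ i, ∀ k, marginalValue U m c x k j ≤ marginalValue U m c x i j :=
      have : Nonempty B := ⟨(hgood j).choose⟩
      Finite.exists_max _
    choose b hb using hmax
    set p : G → ℝ := fun j => marginalValue U m c x (b j) j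
    have hp (j : G) : 0 < p j := by
      obtain ⟨i, hi⟩ := hgood j
      exact (div_pos (mul_pos (hm i) hi) (hfeas.2 i)).trans_le (hb j i)
    have hy : IsAllocation fun (i : B) (j : G) => if i = b j then 1 else 0 :=
      ⟨fun i j => by dsimp only; split_ifs <;> norm_num, fun j => by simp⟩
    have hfirst := sum_marginalValue_le_of_optimal hm hfeas hopt hy
    simp only [mul_ite, mul_one, mul_zero, sum_ite_eq', mem_univ, if_true] at hfirst
    have hslack (i : B) (j : G) : 0 ≤ (p j - marginalValue U m c x i j) * x i j :=
      mul_nonneg (sub_nonneg.2 (hb j i)) (hfeas.1.1 i j)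
    have hunsold (j : G) : 0 ≤ p j * (1 - ∑ i, x i j) :=
      mul_nonneg (hp j).le (sub_nonneg.2 (hfeas.1.2 j))
    have hgap (j : G) : ∑ i, (p j - marginalValue U m c x i j) * x i j + p j * (1 - ∑ i, x i j) =
        p j - ∑ i, marginalValue U m c x i j * x i j := by
      simp only [sub_mul, sum_sub_distrib, ← mul_sum]
      ring
    have hgap_nonneg (j : G) : 0 ≤ p j - ∑ i, marginalValue U m c x i j * x i j :=
      hgap j ▸ add_nonneg (sum_nonneg fun i _ => hslack i j) (hunsold j)
    have hgap_zero (j : G) : p j - ∑ i, marginalValue U m c x i j * x i j = 0 := by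
      refine (sum_eq_zero_iff_of_nonneg fun j _ => hgap_nonneg j).1 ?_ j (mem_univ j)
      refine le_antisymm ?_ (sum_nonneg fun j _ => hgap_nonneg j)
      rw [sum_sub_distrib]
      exact sub_nonpos.2 hfirst
    have hzero (j : G) := (add_eq_zero_iff_of_nonneg (sum_nonneg fun i _ => hslack i j)
      (hunsold j)).1 ((hgap j).trans (hgap_zero j))
    refine ⟨p, hp, fun j => ?_, fun i j => ⟨(hle p hp i j).2 (hb j i), fun hx => ?_⟩⟩
    · linarith [(mul_eq_zero.1 (hzero j).2).resolve_left (hp j).ne']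
    · have h := (sum_eq_zero_iff_of_nonneg fun i _ => hslack i j).1 (hzero j).1 i (mem_univ i)
      exact (heq p hp i j).2 (sub_eq_zero.1 ((mul_eq_zero.1 h).resolve_right hx.ne')).symm
  · rintro ⟨p, hp, hsold, hkkt⟩ y hy
    have hlin := objADNB_sub_le hm hfeas.2 hy.2
    rw [sum_surplus_diff_div] at hlin
    have hy_le : ∑ j, ∑ i, marginalValue U m c x i j * y i j ≤ ∑ j, p j :=
      sum_le_sum fun j _ => calc
        ∑ i, marginalValue U m c x i j * y i j ≤ ∑ i, p j * y i j := sum_le_sum fun i _ =>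
          mul_le_mul_of_nonneg_right ((hle p hp i j).1 (hkkt i j).1) (hy.1.1 i j)
        _ = p j * ∑ i, y i j := (mul_sum _ _ _).symm
        _ ≤ p j := mul_le_of_le_one_right (hp j).le (hy.1.2 j)
    have hx_eq : ∑ j, ∑ i, marginalValue U m c x i j * x i j = ∑ j, p j := by
      refine sum_congr rfl fun j _ => ?_
      rw [← mul_one (p j), ← hsold j, mul_sum]
      refine sum_congr rfl fun i _ => ?_
      rcases (hfeas.1.1 i j).eq_or_lt with h | h
      · simp [← h]
      · rw [(heq p hp i j).1 ((hkkt i j).2 h)]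
    linarith
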